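/- The image of the open unit disk under the Koebe function K(z) = z/(1-z)^2 equals ℂ \ (-∞, -1/4], the complex plane with the real ray from -∞ to -1/4 removed. -/

import Mathlib

/-- The right half-plane consists of the points closer to `1` than to `-1`. -/
lemma Complex.norm_sub_one_lt_norm_add_one_iff (u : ℂ) : ‖u - 1‖ < ‖u + 1‖ ↔ 0 < u.re := by
  rw [← sq_lt_sq₀ (norm_nonneg _) (norm_nonneg _), Complex.sq_norm, Complex.sq_norm,
    Complex.normSq_apply, Complex.normSq_apply]
  simp only [Complex.sub_re, Complex.sub_im, Complex.add_re, Complex.add_im, Complex.one_re,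
    Complex.one_im]
  constructor <;> intro h <;> nlinarith

/-- The squares of points of the right half-plane are not nonpositive reals. -/
lemma Complex.sq_ne_ofReal_of_re_pos {u : ℂ} (hu : 0 < u.re) {x : ℝ} (hx : x ≤ 0) :
    u ^ 2 ≠ (x : ℂ) := by
  intro h
  have hre := congrArg Complex.re h
  have him := congrArg Complex.im h
  simp only [sq, Complex.mul_re, Complex.mul_im, Complex.ofReal_re, Complex.ofReal_im] at hre him
  have h0 : u.re * u.im = 0 := by linarith
  have h1 : u.im = 0 := (mul_eq_zero.mp h0).resolve_left hu.ne'
  rw [h1] at hre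
  nlinarith

/-- A complex number that is not a nonpositive real has a square root in the right half-plane. -/
lemma Complex.exists_sq_eq_of_re_pos {v : ℂ} (hv : ∀ x : ℝ, x ≤ 0 → v ≠ (x : ℂ)) :
    ∃ u : ℂ, 0 < u.re ∧ u ^ 2 = v := by
  obtain ⟨u, hu⟩ := IsAlgClosed.exists_pow_nat_eq v two_pos
  rcases lt_trichotomy u.re 0 with h | h | h
  · exact ⟨-u, by simpa using h, by rw [neg_sq, hu]⟩
  · refine absurd ?_ (hv (-u.im ^ 2) (by nlinarith [sq_nonneg u.im]))
    rw [← hu]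
    apply Complex.ext <;> simp [sq, h]
  · exact ⟨u, h, hu⟩

theorem stmt_4 :
    (fun z : ℂ => z / (1 - z) ^ 2) '' Metric.ball 0 1 =
      {w : ℂ | ¬ ∃ x : ℝ, x ≤ -(1 / 4) ∧ w = (x : ℂ)} := by
  ext w
  simp only [Set.mem_image, mem_ball_zero_iff, Set.mem_ofPred_eq]
  constructor
  · rintro ⟨z, hz, rfl⟩ ⟨x, hx, h⟩
    have hz1 : 1 - z ≠ 0 := by
      intro h0
      rw [← sub_eq_zero.mp h0, norm_one] at hz
      exact lt_irrefl _ hz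
    have hsub : (1 + z) / (1 - z) - 1 = z * ((1 + z) / (1 - z) + 1) := by
      field_simp
      ring
    have hadd : (1 + z) / (1 - z) + 1 ≠ 0 := by
      have : (1 + z) / (1 - z) + 1 = 2 / (1 - z) := by
        field_simp
        ring
      rw [this]
      exact div_ne_zero two_ne_zero hz1
    have hre : 0 < ((1 + z) / (1 - z)).re := by
      rw [← Complex.norm_sub_one_lt_norm_add_one_iff, hsub, norm_mul]
      exact mul_lt_of_lt_one_left (norm_pos_iff.mpr hadd) hz
    refine Complex.sq_ne_ofReal_of_re_pos hre (x := 1 + 4 * x) (by linarith) ?_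
    push_cast
    rw [← h]
    field_simp
    ring
  · intro hw
    obtain ⟨u, hre, hu⟩ := Complex.exists_sq_eq_of_re_pos (v := 1 + 4 * w) (by
      intro x hx h
      refine hw ⟨(x - 1) / 4, by linarith, ?_⟩
      push_cast
      rw [← h]
      ring)
    have hlt := (Complex.norm_sub_one_lt_norm_add_one_iff u).mpr hre
    have hpos : 0 < ‖u + 1‖ := (norm_nonneg _).trans_lt hlt
    have hne : u + 1 ≠ 0 := norm_pos_iff.mp hpos
    refine ⟨(u - 1) / (u + 1), by rwa [norm_div, div_lt_one hpos], ?_⟩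
    have hsub : 1 - (u - 1) / (u + 1) = 2 / (u + 1) := by
      field_simp
      ring
    rw [hsub]
    field_simp
    linear_combination hu
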